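/- arXiv:math/9903170 — 2 statements merged into one kernel-verified Lean document; each statement's English description precedes it below -/
import Mathlib

section
/- Let A₅(n) denote the number of permutations of length n containing no 132 pattern and exactly five 123 patterns. Then in ℚ[[z]], the generating function F₅(z) = ∑_{n≥0} A₅(n)·zⁿ satisfies (1 - 2z)⁶·F₅(z) = z⁵·(z - 1)·(z⁵ - 3z⁴ + 19z³ - 25z² + 12z - 2). -/
/-- The number of 132 patterns of a permutation `π` of `Fin n`:
triples of indices `i₁ < i₂ < i₃` with `π i₁ < π i₃ < π i₂`. -/
def count132 {n : ℕ} (π : Equiv.Perm (Fin n)) : ℕ :=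
  (Finset.univ.filter (fun p : Fin n × Fin n × Fin n =>
    p.1 < p.2.1 ∧ p.2.1 < p.2.2 ∧ π p.1 < π p.2.2 ∧ π p.2.2 < π p.2.1)).card

/-- The number of 123 patterns of a permutation `π` of `Fin n`:
triples of indices `i₁ < i₂ < i₃` with `π i₁ < π i₂ < π i₃`. -/
def count123 {n : ℕ} (π : Equiv.Perm (Fin n)) : ℕ :=
  (Finset.univ.filter (fun p : Fin n × Fin n × Fin n =>
    p.1 < p.2.1 ∧ p.2.1 < p.2.2 ∧ π p.1 < π p.2.1 ∧ π p.2.1 < π p.2.2)).card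

/-- The number of 12 patterns of a permutation `π` of `Fin n`:
pairs of indices `i₁ < i₂` with `π i₁ < π i₂`. -/
def count12 {n : ℕ} (π : Equiv.Perm (Fin n)) : ℕ :=
  (Finset.univ.filter (fun p : Fin n × Fin n =>
    p.1 < p.2 ∧ π p.1 < π p.2)).card

/-- The number of permutations of length n with no 132 pattern and exactly 5 123 patterns. -/
def A (n : ℕ) : ℕ :=
  (Finset.univ.filter (fun π : Equiv.Perm (Fin n) =>
    count132 π = 0 ∧ count123 π = 5)).card

def c12 {n : ℕ} (f : Fin n → ℕ) : ℕ := ∑ a, ∑ b, if a < b ∧ f a < f b then 1 else 0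
def c123 {n : ℕ} (f : Fin n → ℕ) : ℕ :=
  ∑ a, ∑ b, ∑ c, if a < b ∧ b < c ∧ f a < f b ∧ f b < f c then 1 else 0
def c132 {n : ℕ} (f : Fin n → ℕ) : ℕ :=
  ∑ a, ∑ b, ∑ c, if a < b ∧ b < c ∧ f a < f c ∧ f c < f b then 1 else 0

structure IsGlue {i j : ℕ} (f : Fin (i + (j + 1)) → ℕ) (g : Fin i → ℕ) (h : Fin j → ℕ) : Prop where
  hL : ∀ a, f (Fin.castAdd (j + 1) a) = j + g a
  hM : f (Fin.natAdd i 0) = i + j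
  hR : ∀ c, f (Fin.natAdd i (Fin.succ c)) = h c
  hg : ∀ a, g a < i
  hh : ∀ c, h c < j

theorem IsGlue.counts {i j : ℕ} {f : Fin (i + (j + 1)) → ℕ} {g : Fin i → ℕ} {h : Fin j → ℕ}
    (H : IsGlue f g h) : c12 f = c12 g + c12 h + i ∧ c123 f = c123 g + c123 h + c12 g ∧
      c132 f = c132 g + c132 h := by
  obtain ⟨hL, hM, hR, hg, hh⟩ := H
  have e1 : ∀ a c, ¬ (j + g a < h c) := fun a c => by have := hh c; omega
  have e2 : ∀ a c, (h c < j + g a) := fun a c => by have := hh c; omega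
  have e3 : ∀ a, j + g a < i + j := fun a => by have := hg a; omega
  have e4 : ∀ a, ¬ i + j < j + g a := fun a => by have := hg a; omega
  have e5 : ∀ c, h c < i + j := fun a => by have := hh a; omega
  have e6 : ∀ c, ¬ i + j < h c := fun a => by have := hh a; omega
  have p1 : ∀ (a : Fin i) (c : Fin (j + 1)), Fin.castAdd (j + 1) a < Fin.natAdd i c :=
    fun a c => by rw [Fin.lt_def, Fin.val_castAdd, Fin.val_natAdd]; omega
  have p2 : ∀ (a : Fin i) (c : Fin (j + 1)), ¬ Fin.natAdd i c < Fin.castAdd (j + 1) a :=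
    fun a c => by rw [Fin.lt_def, Fin.val_castAdd, Fin.val_natAdd]; omega
  have p3 : ∀ (a b : Fin i), Fin.castAdd (j + 1) a < Fin.castAdd (j + 1) b ↔ a < b :=
    fun a c => Iff.rfl
  have p4 : ∀ (a b : Fin (j + 1)), Fin.natAdd i a < Fin.natAdd i b ↔ a < b :=
    fun a c => by rw [Fin.lt_def, Fin.lt_def, Fin.val_natAdd, Fin.val_natAdd]; omega
  refine ⟨?_, ?_, ?_⟩
  · simp only [c12, Fin.sum_univ_add, Fin.sum_univ_succ]
    simp [hL, hM, hR, e1, e2, e3, e4, e5, e6, p1, p2, p3, p4, Finset.sum_add_distrib, -Fin.natAdd_zero]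
    ring
  · simp only [c12, c123, Fin.sum_univ_add, Fin.sum_univ_succ]
    simp [hL, hM, hR, e1, e2, e3, e4, e5, e6, p1, p2, p3, p4, Finset.sum_add_distrib, -Fin.natAdd_zero]
    ring
  · simp only [c132, Fin.sum_univ_add, Fin.sum_univ_succ]
    simp [hL, hM, hR, e1, e2, e3, e4, e5, e6, p1, p2, p3, p4, Finset.sum_add_distrib, -Fin.natAdd_zero]

def pf {n : ℕ} (π : Equiv.Perm (Fin n)) : Fin n → ℕ := fun x => (π x : ℕ)

theorem count12_eq {n : ℕ} (π : Equiv.Perm (Fin n)) : count12 π = c12 (pf π) := by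
  simp only [count12, c12, pf, Finset.card_filter, Fintype.sum_prod_type, Fin.lt_def]
theorem count123_eq {n : ℕ} (π : Equiv.Perm (Fin n)) : count123 π = c123 (pf π) := by
  simp only [count123, c123, pf, Finset.card_filter, Fintype.sum_prod_type, Fin.lt_def]
theorem count132_eq {n : ℕ} (π : Equiv.Perm (Fin n)) : count132 π = c132 (pf π) := by
  simp only [count132, c132, pf, Finset.card_filter, Fintype.sum_prod_type, Fin.lt_def]

def gf {i j : ℕ} (σ : Equiv.Perm (Fin i)) (τ : Equiv.Perm (Fin j)) :
    Fin (i + (j + 1)) → Fin (i + (j + 1)) :=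
  Fin.addCases (fun a => ⟨j + σ a, by omega⟩)
    (Fin.cases ⟨i + j, by omega⟩ (fun c => ⟨τ c, by omega⟩))

theorem gf_isGlue {i j : ℕ} (σ : Equiv.Perm (Fin i)) (τ : Equiv.Perm (Fin j)) :
    IsGlue (fun x => (gf σ τ x : ℕ)) (pf σ) (pf τ) where
  hL a := by simp [gf, pf]
  hM := by simp only [gf, Fin.addCases_right, Fin.cases_zero]
  hR c := by simp only [gf, pf, Fin.addCases_right, Fin.cases_succ]
  hg a := (σ a).2
  hh a := (τ a).2

theorem pos_cases {i j : ℕ} (x : Fin (i + (j + 1))) :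
    (∃ a, x = Fin.castAdd (j + 1) a) ∨ x = Fin.natAdd i 0 ∨
      ∃ c : Fin j, x = Fin.natAdd i c.succ := by
  induction x using Fin.addCases with
  | left a => exact Or.inl ⟨a, rfl⟩
  | right b =>
    induction b using Fin.cases with
    | zero => exact Or.inr (Or.inl rfl)
    | succ c => exact Or.inr (Or.inr ⟨c, rfl⟩)

theorem gf_inj {i j : ℕ} (σ : Equiv.Perm (Fin i)) (τ : Equiv.Perm (Fin j)) :
    Function.Injective (gf σ τ) := by
  obtain ⟨hL, hM, hR, hg, hh⟩ := gf_isGlue σ τ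
  intro x y hxy
  have h : (gf σ τ x : ℕ) = gf σ τ y := by rw [hxy]
  rcases pos_cases x with ⟨a, rfl⟩ | rfl | ⟨c, rfl⟩ <;>
  rcases pos_cases y with ⟨a', rfl⟩ | rfl | ⟨c', rfl⟩ <;>
  simp only [hL, hM, hR] at h
  · have : σ a = σ a' := by
      simp only [pf] at h; ext; omega
    rw [σ.injective this]
  · have := hg a; omega
  · have := hh c'; omega
  · have := hg a'; omega
  · rfl
  · have := hh c'; omega
  · have := hh c; omega
  · have := hh c; omega
  · have : τ c = τ c' := by
      simp only [pf] at h; ext; omega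
    rw [τ.injective this]

noncomputable def glue {i j : ℕ} (σ : Equiv.Perm (Fin i)) (τ : Equiv.Perm (Fin j)) :
    Equiv.Perm (Fin (i + (j + 1))) :=
  Equiv.ofBijective (gf σ τ) (Finite.injective_iff_bijective.1 (gf_inj σ τ))

theorem glue_isGlue {i j : ℕ} (σ : Equiv.Perm (Fin i)) (τ : Equiv.Perm (Fin j)) :
    IsGlue (pf (glue σ τ)) (pf σ) (pf τ) := gf_isGlue σ τ

theorem pf_inj {n : ℕ} {σ τ : Equiv.Perm (Fin n)} (h : pf σ = pf τ) : σ = τ := by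
  ext x; exact congrFun h x

theorem glue_inj {i j : ℕ} {σ σ' : Equiv.Perm (Fin i)} {τ τ' : Equiv.Perm (Fin j)}
    (h : glue σ τ = glue σ' τ') : σ = σ' ∧ τ = τ' := by
  have h1 := glue_isGlue σ τ
  have h2 := glue_isGlue σ' τ'
  rw [← h] at h2
  constructor
  · apply pf_inj; funext a
    have := h1.hL a; have := h2.hL a; omega
  · apply pf_inj; funext a
    have := h1.hR a; have := h2.hR a; omega

theorem glue_surj {i j : ℕ} (π : Equiv.Perm (Fin (i + (j + 1)))) (h0 : c132 (pf π) = 0)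
    (hm : pf π (Fin.natAdd i 0) = i + j) : ∃ σ τ, glue σ τ = π := by
  have inj : ∀ x y, pf π x = pf π y → x = y := fun x y h => π.injective (Fin.ext h)
  have lt : ∀ x, pf π x < i + (j + 1) := fun x => (π x).2
  have h132 : ∀ a b c, a < b → b < c → pf π a < pf π c → pf π c < pf π b → False := by
    intro a b c h1 h2 h3 h4
    simp only [c132, Finset.sum_eq_zero_iff, Finset.mem_univ, true_imp_iff] at h0
    have := h0 a b c
    simp [h1, h2, h3, h4] at this
  have key : ∀ p q : Fin (i + (j + 1)), (p : ℕ) ≤ i → i < (q : ℕ) → pf π q < pf π p := by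
    intro p q hp hq
    have hqm : pf π q ≠ i + j := by
      intro h
      have := congrArg Fin.val (inj _ _ (h.trans hm.symm))
      simp at this; omega
    have hql := lt q
    rcases hp.lt_or_eq with hp | hp
    · by_contra hlt
      have hne : pf π p ≠ pf π q := by
        intro h
        have := congrArg Fin.val (inj _ _ h); omega
      refine h132 p (Fin.natAdd i 0) q ?_ ?_ (by omega) (by omega)
      · rw [Fin.lt_def]; simpa using hp
      · rw [Fin.lt_def]; simpa using hq
    · have : p = Fin.natAdd i 0 := by ext; simpa using hp
      rw [this, hm]; omega
  have hLge : ∀ a : Fin i, j ≤ pf π (Fin.castAdd (j + 1) a) := by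
    intro a
    have := Fintype.card_le_of_injective
      (fun c : Fin j => (⟨pf π (Fin.natAdd i c.succ),
        key _ _ (by simp) (by simp)⟩ : Fin (pf π (Fin.castAdd (j + 1) a))))
      (by
        intro c c' h
        have := congrArg Fin.val (inj (Fin.natAdd i c.succ) (Fin.natAdd i c'.succ) (by have h := congrArg Fin.val h; exact h))
        ext; simp at this; omega)
    simpa using this
  have hRlt : ∀ c : Fin j, pf π (Fin.natAdd i c.succ) < j := by
    intro c
    have kk : ∀ x : Fin (i + 1), pf π (Fin.natAdd i c.succ) < pf π ⟨x, by omega⟩ :=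
      fun x => key _ _ (by simp; omega) (by simp)
    have := Fintype.card_le_of_injective
      (fun x : Fin (i + 1) => (⟨pf π ⟨x, by omega⟩ - (pf π (Fin.natAdd i c.succ) + 1), by
        have := kk x
        have := lt ⟨x, by omega⟩
        omega⟩ : Fin (i + j - pf π (Fin.natAdd i c.succ))))
      (by
        intro x y h
        have h := congrArg Fin.val h
        simp only at h
        have h1 := kk x
        have h2 := kk y
        have := congrArg Fin.val (inj ⟨x, by omega⟩ ⟨y, by omega⟩ (by omega))
        ext; exact this)
    simp only [Fintype.card_fin] at this
    omega
  have hLlt : ∀ a : Fin i, pf π (Fin.castAdd (j + 1) a) < i + j := by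
    intro a
    have h1 := lt (Fin.castAdd (j + 1) a)
    have : pf π (Fin.castAdd (j + 1) a) ≠ i + j := by
      intro h
      have := congrArg Fin.val (inj _ _ (h.trans hm.symm))
      simp at this; omega
    omega
  let s : Fin i → Fin i := fun a => ⟨pf π (Fin.castAdd (j + 1) a) - j, by
    have := hLlt a; have := hLge a; omega⟩
  let t : Fin j → Fin j := fun c => ⟨pf π (Fin.natAdd i c.succ), hRlt c⟩
  have hs : Function.Injective s := by
    intro a b h
    have h := congrArg Fin.val h
    simp only [s] at h
    have := hLge a
    have := hLge b
    have := congrArg Fin.val (inj (Fin.castAdd (j + 1) a) (Fin.castAdd (j + 1) b) (by omega))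
    ext; simpa using this
  have ht : Function.Injective t := by
    intro a b h
    have := congrArg Fin.val (inj (Fin.natAdd i a.succ) (Fin.natAdd i b.succ) (by have h := congrArg Fin.val h; exact h))
    ext; simp at this; omega
  refine ⟨Equiv.ofBijective s (Finite.injective_iff_bijective.1 hs),
    Equiv.ofBijective t (Finite.injective_iff_bijective.1 ht), ?_⟩
  apply pf_inj
  have G := glue_isGlue (Equiv.ofBijective s (Finite.injective_iff_bijective.1 hs))
    (Equiv.ofBijective t (Finite.injective_iff_bijective.1 ht))
  funext x
  rcases pos_cases x with ⟨a, rfl⟩ | rfl | ⟨c, rfl⟩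
  · rw [G.hL]
    have := hLge a
    simp only [pf, Equiv.ofBijective_apply, s] at this ⊢
    omega
  · rw [G.hM, hm]
  · rw [G.hR]
    simp [pf, t]

open PowerSeries

def W (k : ℕ) {n : ℕ} (π : Equiv.Perm (Fin n)) : ℕ :=
  k.choose 2 * n + k * c12 (pf π) + c123 (pf π)

def Av (n : ℕ) : Finset (Equiv.Perm (Fin n)) := Finset.univ.filter (fun π => c132 (pf π) = 0)

noncomputable def P (k n : ℕ) : PowerSeries ℚ := ∑ π ∈ Av n, X ^ W k π

theorem W_glue (k : ℕ) {i j : ℕ} (σ : Equiv.Perm (Fin i)) (τ : Equiv.Perm (Fin j)) :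
    W k (glue σ τ) = k.choose 2 + W (k + 1) σ + W k τ := by
  obtain ⟨h1, h2, -⟩ := (glue_isGlue σ τ).counts
  have : (k + 1).choose 2 = k + k.choose 2 := by
    rw [Nat.choose_succ_succ' k 1, Nat.choose_one_right]
  simp only [W, h1, h2, this]
  ring

theorem P_fiber (k i j : ℕ) :
    ∑ π ∈ (Av (i + (j + 1))).filter (fun π => pf π (Fin.natAdd i 0) = i + j),
      (X : PowerSeries ℚ) ^ W k π = X ^ k.choose 2 * P (k + 1) i * P k j := by
  rw [P, P, mul_assoc, Finset.sum_mul_sum, ← Finset.sum_product', Finset.mul_sum]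
  symm
  refine Finset.sum_bij (fun p _ => glue p.1 p.2) ?_ ?_ ?_ ?_
  · rintro ⟨σ, τ⟩ h
    simp only [Av, Finset.mem_product, Finset.mem_filter, Finset.mem_univ, true_and] at h ⊢
    have G := glue_isGlue σ τ
    refine ⟨?_, G.hM⟩
    rw [G.counts.2.2, h.1, h.2]
  · rintro ⟨σ, τ⟩ _ ⟨σ', τ'⟩ _ h
    obtain ⟨h1, h2⟩ := glue_inj h
    exact Prod.ext h1 h2
  · intro π h
    simp only [Av, Finset.mem_filter, Finset.mem_univ, true_and] at h
    obtain ⟨σ, τ, e⟩ := glue_surj π h.1 h.2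
    refine ⟨⟨σ, τ⟩, ?_, e⟩
    have := (glue_isGlue σ τ).counts.2.2
    rw [e, h.1] at this
    simp only [Av, Finset.mem_product, Finset.mem_filter, Finset.mem_univ, true_and]
    omega
  · rintro ⟨σ, τ⟩ _
    simp only [W_glue, pow_add, mul_assoc]

theorem P_zero (k : ℕ) : P k 0 = 1 := by
  have : Av 0 = Finset.univ := by
    ext; simp [Av, c132]
  simp [P, this, W, c12, c123]

theorem P_succ (k n : ℕ) : P k (n + 1) =
    ∑ p ∈ Finset.HasAntidiagonal.antidiagonal n, X ^ k.choose 2 * P (k + 1) p.1 * P k p.2 := by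
  rw [Finset.Nat.sum_antidiagonal_eq_sum_range_succ_mk, Finset.sum_range, P,
    ← Finset.sum_fiberwise (Av (n + 1)) (fun π => π.symm (Fin.last n))]
  refine Finset.sum_congr rfl ?_
  rintro ⟨i, hi⟩ _
  obtain ⟨j, rfl⟩ := Nat.exists_eq_add_of_le (Nat.lt_succ_iff.1 hi)
  simp only [Nat.add_sub_cancel_left]
  rw [← P_fiber]
  refine Finset.sum_congr ?_ (fun _ _ => rfl)
  refine Finset.filter_congr (fun π _ => ?_)
  rw [Equiv.symm_apply_eq]
  constructor
  · intro h
    exact (congrArg Fin.val h).symm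
  · intro h
    exact (Fin.ext h).symm

noncomputable def F (k : ℕ) : PowerSeries (PowerSeries ℚ) := mk (P k)

theorem F_eq (k : ℕ) : F k = 1 + X * C (X : PowerSeries ℚ) ^ k.choose 2 * F (k + 1) * F k := by
  ext1 n
  cases n with
  | zero => simp [F, P_zero, mul_assoc]
  | succ n =>
    rw [mul_assoc, mul_assoc, map_add, coeff_succ_X_mul, ← map_pow, coeff_C_mul, coeff_mul]
    simp [F, P_succ, Finset.mul_sum, mul_assoc, coeff_one]

/-- coefficient extraction in the inner variable -/
noncomputable def L (m : ℕ) (G : PowerSeries (PowerSeries ℚ)) : PowerSeries ℚ :=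
  mk (fun n => coeff m (coeff n G))

theorem L_add (m : ℕ) (G H) : L m (G + H) = L m G + L m H := by
  ext; simp [L]
theorem L_sub (m : ℕ) (G H) : L m (G - H) = L m G - L m H := by
  ext; simp [L]
theorem L_X (m : ℕ) (G) : L m (X * G) = X * L m G := by
  ext n; cases n <;> simp [L, coeff_succ_X_mul]
theorem L_T (m : ℕ) (G) : L (m + 1) (C X * G) = L m G := by
  ext n; simp [L, coeff_C_mul, coeff_succ_X_mul]
theorem L_T0 (G) : L 0 (C X * G) = 0 := by
  ext n; simp [L, coeff_C_mul]
theorem L_one0 : L 0 1 = 1 := by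
  ext n; simp [L, coeff_one]
theorem L_one (m : ℕ) : L (m + 1) 1 = 0 := by
  ext n; simp [L, coeff_one]; split_ifs <;> simp [coeff_one]

theorem L_A : mk (fun n => (A n : ℚ)) = L 5 (F 0) := by
  ext n
  simp only [L, F, coeff_mk, P, map_sum, coeff_X_pow, A, count132_eq, count123_eq]
  rw [Finset.sum_boole, Av, Finset.filter_filter]
  simp [W, eq_comm]

theorem F_main : ∃ S, F 0 = X * F 0 + X * F 0 + C X * (X * F 0) - C X * (X * (X * F 0))
    + C X * (C X * (C X * (X * F 0))) - C X * (C X * (C X * (X * (X * F 0))))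
    - C X * (C X * (C X * (X * (X * F 0))))
    + 1 - X - C X * X - C X * (C X * (C X * X)) + C X * (C X * (C X * (X * X)))
    + C X * (C X * (C X * (C X * (C X * (C X * S))))) := by
  have h0 := F_eq 0
  have h1 := F_eq 1
  have h2 := F_eq 2
  have h3 := F_eq 3
  have h4 := F_eq 4
  norm_num [Nat.choose] at h0 h1 h2 h3 h4
  generalize F 0 = f0 at *
  generalize F 1 = f1 at *
  generalize F 2 = f2 at *
  generalize F 3 = f3 at *
  generalize F 4 = f4 at *
  generalize F 5 = f5 at *
  generalize (C (X : PowerSeries ℚ)) = t at *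
  generalize (X : PowerSeries (PowerSeries ℚ)) = z at *
  have e2 : f2 * (1 - z * t ^ 3 * f4 - z * t) = 1 - z * t ^ 3 * f4 := by
    linear_combination (1 - z * t ^ 3 * f4) * h2 + z * t * f2 * h3
  have e1 : f1 * (1 - z * t ^ 3 * f4 - z * t - z * (1 - z * t ^ 3 * f4))
      = 1 - z * t ^ 3 * f4 - z * t := by
    linear_combination (1 - z * t ^ 3 * f4 - z * t) * h1 + z * f1 * e2
  have e0 : f0 * (1 - z * t ^ 3 * f4 - z * t - z * (1 - z * t ^ 3 * f4)
      - z * (1 - z * t ^ 3 * f4 - z * t))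
      = 1 - z * t ^ 3 * f4 - z * t - z * (1 - z * t ^ 3 * f4) := by
    linear_combination (1 - z * t ^ 3 * f4 - z * t - z * (1 - z * t ^ 3 * f4)) * h0 + z * f0 * e1
  refine ⟨t ^ 3 * z * f5 * f4 * ((-z + z ^ 2) + f0 * (z - 2 * z ^ 2)), ?_⟩
  linear_combination e0 + t ^ 3 * ((-z + z ^ 2) + f0 * (z - 2 * z ^ 2)) * h4

theorem genfun_no132_5 :
    (1 - 2 * PowerSeries.X) ^ 6 * PowerSeries.mk (fun n => (A n : ℚ)) = PowerSeries.X ^ 5 * (PowerSeries.X - 1) * (PowerSeries.X ^ 5 - 3 * PowerSeries.X ^ 4 + 19 * PowerSeries.X ^ 3 - 25 * PowerSeries.X ^ 2 + 12 * PowerSeries.X - 2) := by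
  rw [L_A]
  obtain ⟨S, h⟩ := F_main
  have g0 := congrArg (L 0) h
  have g1 := congrArg (L 1) h
  have g2 := congrArg (L 2) h
  have g3 := congrArg (L 3) h
  have g4 := congrArg (L 4) h
  have g5 := congrArg (L 5) h
  have hX : ∀ m, L m X = X * L m 1 := fun m => by rw [← L_X, mul_one]
  have r0 := L_one0
  have r1 := L_one 0
  have r2 := L_one 1
  have r3 := L_one 2
  have r4 := L_one 3
  have r5 := L_one 4
  norm_num only at r0 r1 r2 r3 r4 r5
  have q1 := L_T 0
  have q2 := L_T 1
  have q3 := L_T 2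
  have q4 := L_T 3
  have q5 := L_T 4
  norm_num only at q1 q2 q3 q4 q5
  simp only [L_add, L_sub, L_X, hX, L_T0, q1, q2, q3, q4, q5, r0, r1, r2, r3, r4, r5] at g0 g1 g2 g3 g4 g5
  generalize L 0 (F 0) = f0 at *
  generalize L 1 (F 0) = f1 at *
  generalize L 2 (F 0) = f2 at *
  generalize L 3 (F 0) = f3 at *
  generalize L 4 (F 0) = f4 at *
  generalize L 5 (F 0) = f5 at *
  generalize (X : PowerSeries ℚ) = z at *
  linear_combination (1 - 2 * z) ^ 5 * g5 + z * (1 - z) * (1 - 2 * z) ^ 4 * g4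
    + (z * (1 - z)) ^ 2 * (1 - 2 * z) ^ 3 * g3
    + ((z * (1 - z)) ^ 3 * (1 - 2 * z) ^ 2 + z * (1 - 2 * z) ^ 5) * g2
    + ((z * (1 - z)) ^ 4 * (1 - 2 * z) + 2 * (z * (1 - z)) * z * (1 - 2 * z) ^ 4) * g1
    + ((z * (1 - z)) ^ 5 + 3 * (z * (1 - z)) ^ 2 * z * (1 - 2 * z) ^ 3) * g0
end

section
/- Let B₃(n) denote the number of permutations of length n containing exactly one 132 pattern and exactly three 123 patterns. Then in ℚ[[z]], the generating function G₃(z) = ∑_{n≥0} B₃(n)·zⁿ satisfies (1 - 2z)⁵·G₃(z) = 2z⁵·(1 - z)·(5z² - 4z + 1). -/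
/-- The number of permutations of length n with exactly one 132 pattern and exactly 3 123 patterns. -/
def B (n : ℕ) : ℕ :=
  (Finset.univ.filter (fun π : Equiv.Perm (Fin n) =>
    count132 π = 1 ∧ count123 π = 3)).card


/-- Insert the minimal value at position `p`. -/
def insMin {n : ℕ} (p : Fin (n + 1)) (σ : Equiv.Perm (Fin n)) : Equiv.Perm (Fin (n + 1)) :=
  ((finSuccEquiv' p).trans σ.optionCongr).trans (finSuccEquiv' 0).symm

@[simp] lemma insMin_self {n : ℕ} (p : Fin (n + 1)) (σ : Equiv.Perm (Fin n)) :
    insMin p σ p = 0 := by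
  simp [insMin]

@[simp] lemma insMin_succAbove {n : ℕ} (p : Fin (n + 1)) (σ : Equiv.Perm (Fin n)) (i : Fin n) :
    insMin p σ (p.succAbove i) = (σ i).succ := by
  simp [insMin]

lemma insMin_bijective (n : ℕ) :
    Function.Bijective (fun q : Fin (n + 1) × Equiv.Perm (Fin n) => insMin q.1 q.2) := by
  rw [Fintype.bijective_iff_injective_and_card]
  constructor
  · rintro ⟨p, σ⟩ ⟨q, τ⟩ h
    simp only at h
    have hpq : p = q := by
      apply (insMin q τ).injective
      rw [insMin_self, ← h, insMin_self]
    subst hpq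
    have : σ = τ := by
      ext i
      have h1 := insMin_succAbove p σ i
      rw [h, insMin_succAbove] at h1
      rw [Fin.succ_injective _ h1]
    rw [this]
  · simp [Fintype.card_perm, Nat.factorial_succ]

/-- The number of descending pairs at positions after the insertion point. -/
def descAfter {n : ℕ} (p : Fin (n + 1)) (σ : Equiv.Perm (Fin n)) : ℕ :=
  ∑ i : Fin n, ∑ j : Fin n, if p ≤ i.castSucc ∧ i < j ∧ σ j < σ i then 1 else 0

/-- The number of ascending pairs at positions after the insertion point. -/
def ascAfter {n : ℕ} (p : Fin (n + 1)) (σ : Equiv.Perm (Fin n)) : ℕ :=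
  ∑ i : Fin n, ∑ j : Fin n, if p ≤ i.castSucc ∧ i < j ∧ σ i < σ j then 1 else 0

lemma count132_insMin {n : ℕ} (p : Fin (n + 1)) (σ : Equiv.Perm (Fin n)) :
    count132 (insMin p σ) = count132 σ + descAfter p σ := by
  simp only [count132, Finset.card_filter, Fintype.sum_prod_type, Fin.sum_univ_succAbove _ p,
    descAfter]
  simp [Fin.lt_succAbove_iff_le_castSucc]
  rw [add_comm]

lemma count123_insMin {n : ℕ} (p : Fin (n + 1)) (σ : Equiv.Perm (Fin n)) :
    count123 (insMin p σ) = count123 σ + ascAfter p σ := by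
  simp only [count123, Finset.card_filter, Fintype.sum_prod_type, Fin.sum_univ_succAbove _ p,
    ascAfter]
  simp [Fin.lt_succAbove_iff_le_castSucc]
  rw [add_comm]

/-- Sum of a weight depending on the pattern of the last three values and on both counts. -/
def T (n : ℕ) (w : Bool → Bool → Bool → ℕ → ℕ → ℤ) : ℤ :=
  ∑ π : Equiv.Perm (Fin (n + 3)),
    w (decide (π ⟨n, by omega⟩ < π ⟨n + 1, by omega⟩))
      (decide (π ⟨n, by omega⟩ < π ⟨n + 2, by omega⟩))
      (decide (π ⟨n + 1, by omega⟩ < π ⟨n + 2, by omega⟩)) (count132 π) (count123 π)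

/-- The transfer operator. -/
def M (w : Bool → Bool → Bool → ℕ → ℕ → ℤ) (x y z : Bool) (i j : ℕ) : ℤ :=
  if i ≤ 1 ∧ j ≤ 3 then
    w z false false i j + w false z true i j +
    w true true z (i + (!z).toNat) (j + z.toNat) +
    w x y z (i + ((!x).toNat + (!y).toNat + (!z).toNat)) (j + (x.toNat + y.toNat + z.toNat))
  else 0

/-- The target weight. -/
def w0 (_ _ _ : Bool) (i j : ℕ) : ℤ := if i = 1 ∧ j = 3 then 1 else 0

def Supp (w : Bool → Bool → Bool → ℕ → ℕ → ℤ) : Prop :=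
  ∀ x y z i j, ¬ (i ≤ 1 ∧ j ≤ 3) → w x y z i j = 0

lemma supp_M (w) : Supp (M w) := by
  intro x y z i j h
  simp [M, h]

lemma supp_w0 : Supp w0 := by
  intro x y z i j h
  unfold w0
  rw [if_neg]
  omega

lemma after_big {n : ℕ} (p : Fin (n + 4)) (hp : p.val < n) (σ : Equiv.Perm (Fin (n + 3))) :
    5 ≤ descAfter p σ + ascAfter p σ := by
  have key : descAfter p σ + ascAfter p σ =
      (Finset.univ.filter (fun q : Fin (n+3) × Fin (n+3) =>
        p ≤ q.1.castSucc ∧ q.1 < q.2)).card := by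
    rw [descAfter, ascAfter, Finset.card_filter, Fintype.sum_prod_type, ← Finset.sum_add_distrib]
    refine Finset.sum_congr rfl fun i _ => ?_
    rw [← Finset.sum_add_distrib]
    refine Finset.sum_congr rfl fun j _ => ?_
    by_cases hij : i < j
    · rcases lt_trichotomy (σ i) (σ j) with h | h | h
      · simp [hij, h, not_lt.2 h.le]
      · exact absurd (σ.injective h) hij.ne
      · simp [hij, h, not_lt.2 h.le]
    · simp [hij]
  rw [key]
  let a : Fin (n+3) := ⟨p.val, by omega⟩
  let b : Fin (n+3) := ⟨n, by omega⟩
  let c : Fin (n+3) := ⟨n+1, by omega⟩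
  let d : Fin (n+3) := ⟨n+2, by omega⟩
  have hsub : ({(a,b),(a,c),(a,d),(b,c),(b,d)} : Finset (Fin (n+3) × Fin (n+3))) ⊆
      Finset.univ.filter (fun q : Fin (n+3) × Fin (n+3) =>
        p ≤ q.1.castSucc ∧ q.1 < q.2) := by
    intro q hq
    simp only [Finset.mem_insert, Finset.mem_singleton] at hq
    rcases hq with rfl | rfl | rfl | rfl | rfl <;>
      simp only [a, b, c, d, Finset.mem_filter, Finset.mem_univ, true_and, Fin.le_def, Fin.lt_def,
        Fin.val_castSucc] <;> omega
  refine le_trans (le_of_eq ?_) (Finset.card_le_card hsub)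
  have h1 : a ≠ b := by simp [a, b, Fin.ext_iff]; omega
  have h2 : b ≠ c := by simp [b, c, Fin.ext_iff]
  have h3 : b ≠ d := by simp [b, d, Fin.ext_iff]
  have h4 : c ≠ d := by simp [c, d, Fin.ext_iff]
  rw [Finset.card_insert_of_notMem, Finset.card_insert_of_notMem, Finset.card_insert_of_notMem,
    Finset.card_insert_of_notMem, Finset.card_singleton] <;> simp [h1, h2, h3, h4]

/-- Indicator sums over pairs past `p`, where `p` lies among the last positions. -/
lemma pairs_sum {n : ℕ} (p : Fin (n + 4)) (hp : n ≤ p.val)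
    (f : Fin (n+3) → Fin (n+3) → Prop) [∀ i j, Decidable (f i j)] :
    (∑ i : Fin (n+3), ∑ j : Fin (n+3), if p ≤ i.castSucc ∧ i < j ∧ f i j then 1 else 0) =
      (if p.val = n ∧ f ⟨n, by omega⟩ ⟨n+1, by omega⟩ then 1 else 0) +
      (if p.val = n ∧ f ⟨n, by omega⟩ ⟨n+2, by omega⟩ then 1 else 0) +
      (if p.val ≤ n + 1 ∧ f ⟨n+1, by omega⟩ ⟨n+2, by omega⟩ then 1 else 0) := by
  rw [← Fintype.sum_prod_type' (f := fun i j => if p ≤ i.castSucc ∧ i < j ∧ f i j then 1 else 0)]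
  let b : Fin (n+3) := ⟨n, by omega⟩
  let c : Fin (n+3) := ⟨n+1, by omega⟩
  let d : Fin (n+3) := ⟨n+2, by omega⟩
  have hb : b ≠ c := by simp [b, c, Fin.ext_iff]
  have hc : c ≠ d := by simp [c, d, Fin.ext_iff]
  rw [← Finset.sum_subset (Finset.subset_univ {(b,c),(b,d),(c,d)})]
  · rw [Finset.sum_insert, Finset.sum_insert, Finset.sum_singleton]
    · have e1 : p ≤ b.castSucc ↔ p.val = n := by simp [b, Fin.le_def]; omega
      have e2 : p ≤ c.castSucc ↔ p.val ≤ n + 1 := by simp [c, Fin.le_def]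
      have l1 : b < c := by simp [b, c, Fin.lt_def]
      have l2 : b < d := by simp [b, d, Fin.lt_def]
      have l3 : c < d := by simp [c, d, Fin.lt_def]
      simp only [e1, e2, l1, l2, l3, true_and]
      simp only [b, c, d, add_assoc]
    · simp [hb]
    · simp [hb, hc]
  · rintro ⟨i, j⟩ _ hij
    rw [if_neg]
    rintro ⟨h1, h2, -⟩
    apply hij
    simp only [Finset.mem_insert, Finset.mem_singleton, Prod.mk.injEq, b, c, d, Fin.ext_iff]
    simp only [Fin.le_def, Fin.lt_def, Fin.val_castSucc] at h1 h2
    omega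

lemma insMin_lt {n : ℕ} (p : Fin (n + 1)) (σ : Equiv.Perm (Fin n)) (i : ℕ) (hi : i < n)
    (h : i < p.val) : insMin p σ ⟨i, by omega⟩ = (σ ⟨i, hi⟩).succ := by
  rw [← insMin_succAbove p, Fin.succAbove_of_castSucc_lt _ _ (by simpa [Fin.lt_def] using h)]
  rfl

lemma insMin_gt {n : ℕ} (p : Fin (n + 1)) (σ : Equiv.Perm (Fin n)) (i : ℕ) (hi : i < n)
    (h : p.val ≤ i) : insMin p σ ⟨i + 1, by omega⟩ = (σ ⟨i, hi⟩).succ := by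
  rw [← insMin_succAbove p, Fin.succAbove_of_le_castSucc _ _ (by simpa [Fin.le_def] using h)]
  rfl

lemma insMin_eq {n : ℕ} (p : Fin (n + 1)) (σ : Equiv.Perm (Fin n)) (i : ℕ) (hi : i < n + 1)
    (h : p.val = i) : insMin p σ ⟨i, hi⟩ = 0 := by
  subst h
  exact insMin_self p σ

lemma T_succ (n : ℕ) (w) (hw : Supp w) : T (n + 1) w = T n (M w) := by
  unfold T
  rw [← (insMin_bijective (n+3)).sum_comp, Fintype.sum_prod_type, Finset.sum_comm]
  refine Finset.sum_congr rfl fun σ _ => ?_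
  simp only [count132_insMin, count123_insMin]
  by_cases hc : count132 σ ≤ 1 ∧ count123 σ ≤ 3
  swap
  · rw [Finset.sum_eq_zero]
    · simp [M, hc]
    · intro p _
      apply hw
      omega
  rw [M, if_pos hc]
  rw [Fin.sum_univ_castSucc, Fin.sum_univ_castSucc, Fin.sum_univ_castSucc, Fin.sum_univ_castSucc,
    Finset.sum_eq_zero, zero_add]
  · have hne : ∀ i j : ℕ, ∀ hi : i < n + 3, ∀ hj : j < n + 3, i ≠ j →
        (σ ⟨j, hj⟩ < σ ⟨i, hi⟩ ↔ ¬ σ ⟨i, hi⟩ < σ ⟨j, hj⟩) := by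
      intro i j hi hj hij
      rw [not_lt]
      refine ⟨le_of_lt, fun h => lt_of_le_of_ne h fun he => hij ?_⟩
      simpa using (σ.injective he).symm
    have d1 := hne n (n+1) (by omega) (by omega) (by omega)
    have d2 := hne n (n+2) (by omega) (by omega) (by omega)
    have d3 := hne (n+1) (n+2) (by omega) (by omega) (by omega)
    have e0 : ∀ p : Fin (n+4), p.val = n + 3 →
        w (decide (insMin p σ ⟨n + 1, by omega⟩ < insMin p σ ⟨n + 1 + 1, by omega⟩))
          (decide (insMin p σ ⟨n + 1, by omega⟩ < insMin p σ ⟨n + 1 + 2, by omega⟩))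
          (decide (insMin p σ ⟨n + 1 + 1, by omega⟩ < insMin p σ ⟨n + 1 + 2, by omega⟩))
          (count132 σ + descAfter p σ) (count123 σ + ascAfter p σ) =
        w (decide (σ ⟨n + 1, by omega⟩ < σ ⟨n + 2, by omega⟩)) false false
          (count132 σ) (count123 σ) := by
      intro p hp
      rw [descAfter, ascAfter, pairs_sum p (by omega) (fun i j => σ j < σ i),
        pairs_sum p (by omega) (fun i j => σ i < σ j),
        insMin_lt p σ (n+1) (by omega) (by omega), insMin_lt p σ (n+1+1) (by omega) (by omega),
        insMin_eq p σ (n+1+2) (by omega) (by omega)]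
      simp [hp]
    have e1 : ∀ p : Fin (n+4), p.val = n + 2 →
        w (decide (insMin p σ ⟨n + 1, by omega⟩ < insMin p σ ⟨n + 1 + 1, by omega⟩))
          (decide (insMin p σ ⟨n + 1, by omega⟩ < insMin p σ ⟨n + 1 + 2, by omega⟩))
          (decide (insMin p σ ⟨n + 1 + 1, by omega⟩ < insMin p σ ⟨n + 1 + 2, by omega⟩))
          (count132 σ + descAfter p σ) (count123 σ + ascAfter p σ) =
        w false (decide (σ ⟨n + 1, by omega⟩ < σ ⟨n + 2, by omega⟩)) true
          (count132 σ) (count123 σ) := by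
      intro p hp
      rw [descAfter, ascAfter, pairs_sum p (by omega) (fun i j => σ j < σ i),
        pairs_sum p (by omega) (fun i j => σ i < σ j),
        insMin_lt p σ (n+1) (by omega) (by omega), insMin_eq p σ (n+1+1) (by omega) (by omega),
        insMin_gt p σ (n+1+1) (by omega) (by omega)]
      simp [hp]
    have e2 : ∀ p : Fin (n+4), p.val = n + 1 →
        w (decide (insMin p σ ⟨n + 1, by omega⟩ < insMin p σ ⟨n + 1 + 1, by omega⟩))
          (decide (insMin p σ ⟨n + 1, by omega⟩ < insMin p σ ⟨n + 1 + 2, by omega⟩))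
          (decide (insMin p σ ⟨n + 1 + 1, by omega⟩ < insMin p σ ⟨n + 1 + 2, by omega⟩))
          (count132 σ + descAfter p σ) (count123 σ + ascAfter p σ) =
        w true true (decide (σ ⟨n + 1, by omega⟩ < σ ⟨n + 2, by omega⟩))
          (count132 σ + (!(decide (σ ⟨n + 1, by omega⟩ < σ ⟨n + 2, by omega⟩))).toNat)
          (count123 σ + (decide (σ ⟨n + 1, by omega⟩ < σ ⟨n + 2, by omega⟩)).toNat) := by
      intro p hp
      rw [descAfter, ascAfter, pairs_sum p (by omega) (fun i j => σ j < σ i),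
        pairs_sum p (by omega) (fun i j => σ i < σ j),
        insMin_eq p σ (n+1) (by omega) (by omega), insMin_gt p σ (n+1) (by omega) (by omega),
        insMin_gt p σ (n+1+1) (by omega) (by omega)]
      simp only [d3]
      by_cases h3 : σ ⟨n + 1, by omega⟩ < σ ⟨n + 2, by omega⟩ <;> simp [hp, h3]
    have e3 : ∀ p : Fin (n+4), p.val = n →
        w (decide (insMin p σ ⟨n + 1, by omega⟩ < insMin p σ ⟨n + 1 + 1, by omega⟩))
          (decide (insMin p σ ⟨n + 1, by omega⟩ < insMin p σ ⟨n + 1 + 2, by omega⟩))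
          (decide (insMin p σ ⟨n + 1 + 1, by omega⟩ < insMin p σ ⟨n + 1 + 2, by omega⟩))
          (count132 σ + descAfter p σ) (count123 σ + ascAfter p σ) =
        w (decide (σ ⟨n, by omega⟩ < σ ⟨n + 1, by omega⟩))
          (decide (σ ⟨n, by omega⟩ < σ ⟨n + 2, by omega⟩))
          (decide (σ ⟨n + 1, by omega⟩ < σ ⟨n + 2, by omega⟩))
          (count132 σ + ((!(decide (σ ⟨n, by omega⟩ < σ ⟨n + 1, by omega⟩))).toNat
            + (!(decide (σ ⟨n, by omega⟩ < σ ⟨n + 2, by omega⟩))).toNat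
            + (!(decide (σ ⟨n + 1, by omega⟩ < σ ⟨n + 2, by omega⟩))).toNat))
          (count123 σ + ((decide (σ ⟨n, by omega⟩ < σ ⟨n + 1, by omega⟩)).toNat
            + (decide (σ ⟨n, by omega⟩ < σ ⟨n + 2, by omega⟩)).toNat
            + (decide (σ ⟨n + 1, by omega⟩ < σ ⟨n + 2, by omega⟩)).toNat)) := by
      intro p hp
      rw [descAfter, ascAfter, pairs_sum p (by omega) (fun i j => σ j < σ i),
        pairs_sum p (by omega) (fun i j => σ i < σ j),
        insMin_gt p σ n (by omega) (by omega), insMin_gt p σ (n+1) (by omega) (by omega),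
        insMin_gt p σ (n+1+1) (by omega) (by omega)]
      simp only [d1, d2, d3]
      by_cases h1 : σ ⟨n, by omega⟩ < σ ⟨n + 1, by omega⟩ <;>
      by_cases h2 : σ ⟨n, by omega⟩ < σ ⟨n + 2, by omega⟩ <;>
      by_cases h3 : σ ⟨n + 1, by omega⟩ < σ ⟨n + 2, by omega⟩ <;> simp [hp, h1, h2, h3]
    rw [e0 (Fin.last _) (by simp), e1 (Fin.last _).castSucc (by simp),
      e2 (Fin.last _).castSucc.castSucc (by simp),
      e3 (Fin.last _).castSucc.castSucc.castSucc (by simp)]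
    ring
  · intro p _
    apply hw
    have := after_big p.castSucc.castSucc.castSucc.castSucc (by simp) σ
    omega

lemma B_eq (n : ℕ) : (B (n + 3) : ℤ) = T n w0 := by
  simp [B, T, w0]

lemma T_iter (k n : ℕ) : ∀ w, Supp w → T (n + k) w = T n (M^[k] w) := by
  induction k with
  | zero => intro w _; rfl
  | succ k ih =>
    intro w hw
    rw [← add_assoc, T_succ _ _ hw, ih _ (supp_M w), Function.iterate_succ_apply]

lemma supp_iter (k : ℕ) : Supp (M^[k] w0) := by
  cases k with
  | zero => exact supp_w0
  | succ k => rw [Function.iterate_succ_apply']; exact supp_M _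

lemma small0 : B 0 = 0 ∧ B 1 = 0 ∧ B 2 = 0 := by decide +kernel

lemma T0 (k : ℕ) : (B (k + 3) : ℤ) = T 0 (M^[k] w0) := by
  rw [B_eq, ← T_iter _ _ _ supp_w0, zero_add]

lemma B_of (k v : ℕ) (h : T 0 (M^[k] w0) = (v : ℤ)) : B (k + 3) = v := by
  rw [← T0] at h
  exact_mod_cast h

lemma smalls : T 0 (M^[0] w0) = 0 ∧ T 0 (M^[1] w0) = 0 ∧ T 0 (M^[2] w0) = 2 ∧
    T 0 (M^[3] w0) = 10 ∧ T 0 (M^[4] w0) = 38 ∧ T 0 (M^[5] w0) = 130 ∧ T 0 (M^[6] w0) = 420 ∧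
    T 0 (M^[7] w0) = 1304 ∧ T 0 (M^[8] w0) = 3920 := by
  decide +kernel

lemma char_fin : ∀ x y z : Bool, ∀ i : Fin 2, ∀ j : Fin 4,
    M^[9] w0 x y z i j - 10 * M^[8] w0 x y z i j + 40 * M^[7] w0 x y z i j
    - 80 * M^[6] w0 x y z i j + 80 * M^[5] w0 x y z i j - 32 * M^[4] w0 x y z i j = 0 := by
  decide +kernel

lemma char_all (x y z : Bool) (i j : ℕ) :
    M^[9] w0 x y z i j - 10 * M^[8] w0 x y z i j + 40 * M^[7] w0 x y z i j
    - 80 * M^[6] w0 x y z i j + 80 * M^[5] w0 x y z i j - 32 * M^[4] w0 x y z i j = 0 := by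
  by_cases h : i ≤ 1 ∧ j ≤ 3
  · exact char_fin x y z ⟨i, by omega⟩ ⟨j, by omega⟩
  · rw [supp_iter 9 x y z i j h, supp_iter 8 x y z i j h, supp_iter 7 x y z i j h,
      supp_iter 6 x y z i j h, supp_iter 5 x y z i j h, supp_iter 4 x y z i j h]
    norm_num

lemma B_rec (n : ℕ) : (B (n + 12) : ℤ) - 10 * B (n + 11) + 40 * B (n + 10) - 80 * B (n + 9)
    + 80 * B (n + 8) - 32 * B (n + 7) = 0 := by
  rw [B_eq (n+9), B_eq (n+8), B_eq (n+7), B_eq (n+6), B_eq (n+5), B_eq (n+4),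
    T_iter 9 _ _ supp_w0, T_iter 8 _ _ supp_w0, T_iter 7 _ _ supp_w0, T_iter 6 _ _ supp_w0,
    T_iter 5 _ _ supp_w0, T_iter 4 _ _ supp_w0]
  unfold T
  simp only [Finset.mul_sum, ← Finset.sum_sub_distrib, ← Finset.sum_add_distrib]
  exact Finset.sum_eq_zero fun π _ => char_all _ _ _ _ _

theorem genfun_one132_3 :
    (1 - 2 * PowerSeries.X) ^ 5 * PowerSeries.mk (fun n => (B n : ℚ)) = 2 * PowerSeries.X ^ 5 * (1 - PowerSeries.X) * (5 * PowerSeries.X ^ 2 - 4 * PowerSeries.X + 1) := by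
  obtain ⟨b0, b1, b2⟩ := small0
  obtain ⟨s0, s1, s2, s3, s4, s5, s6, s7, s8⟩ := smalls
  replace s0 : B 3 = 0 := B_of 0 0 s0
  replace s1 : B 4 = 0 := B_of 1 0 s1
  replace s2 : B 5 = 2 := B_of 2 2 s2
  replace s3 : B 6 = 10 := B_of 3 10 s3
  replace s4 : B 7 = 38 := B_of 4 38 s4
  replace s5 : B 8 = 130 := B_of 5 130 s5
  replace s6 : B 9 = 420 := B_of 6 420 s6
  replace s7 : B 10 = 1304 := B_of 7 1304 s7
  replace s8 : B 11 = 3920 := B_of 8 3920 s8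
  have hl : (1 - 2 * PowerSeries.X) ^ 5 * PowerSeries.mk (fun n => (B n : ℚ)) =
      PowerSeries.mk (fun n => (B n : ℚ))
      - PowerSeries.C 10 * (PowerSeries.X ^ 1 * PowerSeries.mk (fun n => (B n : ℚ)))
      + PowerSeries.C 40 * (PowerSeries.X ^ 2 * PowerSeries.mk (fun n => (B n : ℚ)))
      - PowerSeries.C 80 * (PowerSeries.X ^ 3 * PowerSeries.mk (fun n => (B n : ℚ)))
      + PowerSeries.C 80 * (PowerSeries.X ^ 4 * PowerSeries.mk (fun n => (B n : ℚ)))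
      - PowerSeries.C 32 * (PowerSeries.X ^ 5 * PowerSeries.mk (fun n => (B n : ℚ))) := by
    simp only [map_ofNat]
    ring
  have hr : (2 * PowerSeries.X ^ 5 * (1 - PowerSeries.X) *
      (5 * PowerSeries.X ^ 2 - 4 * PowerSeries.X + 1) : PowerSeries ℚ) =
      PowerSeries.C 2 * PowerSeries.X ^ 5 - PowerSeries.C 10 * PowerSeries.X ^ 6
      + PowerSeries.C 18 * PowerSeries.X ^ 7 - PowerSeries.C 10 * PowerSeries.X ^ 8 := by
    simp only [map_ofNat]
    ring
  rw [hl, hr]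
  ext n
  simp only [map_add, map_sub, PowerSeries.coeff_C_mul, PowerSeries.coeff_X_pow_mul',
    PowerSeries.coeff_mk, PowerSeries.coeff_X_pow]
  by_cases hn : n < 12
  · interval_cases n <;> norm_num [b0, b1, b2, s0, s1, s2, s3, s4, s5, s6, s7, s8]
  · obtain ⟨m, rfl⟩ : ∃ m, n = m + 12 := ⟨n - 12, by omega⟩
    have h := B_rec m
    have h' : (B (m + 12) : ℚ) - 10 * B (m + 11) + 40 * B (m + 10) - 80 * B (m + 9)
      + 80 * B (m + 8) - 32 * B (m + 7) = 0 := by exact_mod_cast h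
    have g5 : m + 12 ≠ 5 := by omega
    have g6 : m + 12 ≠ 6 := by omega
    have g7 : m + 12 ≠ 7 := by omega
    have g8 : m + 12 ≠ 8 := by omega
    rw [if_pos (by omega), if_pos (by omega), if_pos (by omega), if_pos (by omega),
      if_pos (by omega), if_neg g5, if_neg g6, if_neg g7, if_neg g8]
    rw [show m + 12 - 1 = m + 11 by omega, show m + 12 - 2 = m + 10 by omega,
      show m + 12 - 3 = m + 9 by omega, show m + 12 - 4 = m + 8 by omega,
      show m + 12 - 5 = m + 7 by omega]
    linarith
end
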